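/- Let n ≥ 2 and let Σ be a finite set of n×n real matrices such that ‖Ax‖_P ≤ ‖x‖_P for every A ∈ Σ and every x ∈ ℝ^n. If there exists a sequence σ : ℕ → Σ that is noncontracting, then there exist matrices B_1, …, B_p ∈ Σ with 1 ≤ p ≤ p*(n) = C(n, ⌊n/3⌋)·(2^{n − ⌊n/3⌋ − 1} − 1) such that for every k ≥ 1 the power (B_p ⋯ B_1)^k does not contract ‖·‖_P, i.e., for every k there exists x with ‖x‖_P ≤ 1 and ‖(B_p ⋯ B_1)^k x‖_P ≥ 1. -/

import Mathlib

open Filter Matrix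

/-- The seminorm `‖x‖_P = (1/2)(max_i x_i − min_i x_i)`. -/
noncomputable def normP {n : ℕ} (x : Fin n → ℝ) : ℝ :=
  (1 / 2) * ((⨆ i, x i) - ⨅ i, x i)

/-- A matrix `M` contracts `‖·‖_P` if `‖Mx‖_P < 1` whenever `‖x‖_P ≤ 1`. -/
noncomputable def ContractsP {n : ℕ} (M : Matrix (Fin n) (Fin n) ℝ) : Prop :=
  ∀ x : Fin n → ℝ, normP x ≤ 1 → normP (M.mulVec x) < 1

/-- Partial products `P t = σ(t) ⋯ σ(1)` of a sequence of matrices (P 0 = identity). -/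
def partialProd {n : ℕ} (σ : ℕ → Matrix (Fin n) (Fin n) ℝ) : ℕ → Matrix (Fin n) (Fin n) ℝ
  | 0 => 1
  | t + 1 => σ (t + 1) * partialProd σ t

/-- The bound `p*(n) = C(n, ⌊n/3⌋) · (2^(n − ⌊n/3⌋ − 1) − 1)`. -/
def pstar (n : ℕ) : ℕ := n.choose (n / 3) * (2 ^ (n - n / 3 - 1) - 1)

section NormP

variable {n : ℕ}

theorem sub_le_two_mul_normP (x : Fin n → ℝ) (i j : Fin n) : x i - x j ≤ 2 * normP x := by
  have h₁ : x i ≤ ⨆ k, x k := le_ciSup (Set.finite_range x).bddAbove i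
  have h₂ : ⨅ k, x k ≤ x j := ciInf_le (Set.finite_range x).bddBelow j
  unfold normP
  linarith

theorem exists_sub_eq_two_mul_normP [NeZero n] (x : Fin n → ℝ) :
    ∃ i j, x i - x j = 2 * normP x := by
  obtain ⟨i, hi⟩ := exists_eq_ciSup_of_finite (f := x)
  obtain ⟨j, hj⟩ := exists_eq_ciInf_of_finite (f := x)
  refine ⟨i, j, ?_⟩
  rw [hi, hj, normP]
  ring

theorem normP_neg [NeZero n] (x : Fin n → ℝ) : normP (-x) = normP x := by
  obtain ⟨i, j, h⟩ := exists_sub_eq_two_mul_normP x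
  obtain ⟨k, l, h'⟩ := exists_sub_eq_two_mul_normP (-x)
  have h₁ := sub_le_two_mul_normP (-x) j i
  have h₂ := sub_le_two_mul_normP x l k
  simp only [Pi.neg_apply] at h' h₁
  linarith

open Classical in
/-- For a point of the unit ball of `normP`, the face containing it in its relative interior,
encoded by the coordinates where the maximum and the minimum are attained. -/
noncomputable def face (x : Fin n → ℝ) : Finset (Fin n) × Finset (Fin n) :=
  (Finset.univ.filter fun i => ∃ j, x i - x j = 2, Finset.univ.filter fun j => ∃ i, x i - x j = 2)

theorem mem_face_fst {x : Fin n → ℝ} {i : Fin n} :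
    i ∈ (face x).1 ↔ ∃ j, x i - x j = 2 := by
  simp [face]

theorem mem_face_snd {x : Fin n → ℝ} {j : Fin n} :
    j ∈ (face x).2 ↔ ∃ i, x i - x j = 2 := by
  simp [face]

theorem face_neg (x : Fin n → ℝ) : face (-x) = (face x).swap := by
  ext i
  · simp only [mem_face_fst, Prod.fst_swap, mem_face_snd, Pi.neg_apply, neg_sub_neg]
  · simp only [mem_face_fst, Prod.snd_swap, mem_face_snd, Pi.neg_apply, neg_sub_neg]

theorem sub_eq_two_of_mem_face {x : Fin n → ℝ} (hx : normP x ≤ 1) {i j : Fin n}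
    (hi : i ∈ (face x).1) (hj : j ∈ (face x).2) : x i - x j = 2 := by
  obtain ⟨k, hk⟩ := mem_face_fst.1 hi
  obtain ⟨l, hl⟩ := mem_face_snd.1 hj
  have h₁ := sub_le_two_mul_normP x i j
  have h₂ := sub_le_two_mul_normP x l k
  linarith

theorem disjoint_face {x : Fin n → ℝ} (hx : normP x ≤ 1) : Disjoint (face x).1 (face x).2 := by
  refine Finset.disjoint_left.2 fun i hi hj => ?_
  have := sub_eq_two_of_mem_face hx hi hj
  simp at this

theorem face_nonempty [NeZero n] {x : Fin n → ℝ} (hx : normP x = 1) :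
    (face x).1.Nonempty ∧ (face x).2.Nonempty := by
  obtain ⟨i, j, h⟩ := exists_sub_eq_two_mul_normP x
  rw [hx, mul_one] at h
  exact ⟨⟨i, mem_face_fst.2 ⟨j, h⟩⟩, ⟨j, mem_face_snd.2 ⟨i, h⟩⟩⟩

theorem normP_eq_one_of_mem_face {x : Fin n → ℝ} (hx : normP x ≤ 1) {i : Fin n}
    (hi : i ∈ (face x).1) : normP x = 1 := by
  obtain ⟨j, hj⟩ := mem_face_fst.1 hi
  have := sub_le_two_mul_normP x i j
  linarith

/-- A matrix that does not increase `normP`. -/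
def NonexpansiveP (M : Matrix (Fin n) (Fin n) ℝ) : Prop :=
  ∀ x : Fin n → ℝ, normP (M.mulVec x) ≤ normP x

theorem NonexpansiveP.list_prod {l : List (Matrix (Fin n) (Fin n) ℝ)}
    (hl : ∀ M ∈ l, NonexpansiveP M) : NonexpansiveP l.prod := by
  induction l with
  | nil => intro x; simp
  | cons M l ih =>
    intro x
    rw [List.prod_cons, ← Matrix.mulVec_mulVec]
    exact (hl M (by simp) _).trans (ih (fun N hN => hl N (by simp [hN])) x)

/-- If `y` lies in the closed face spanned by `x`, then `x` can be pushed away from `y` without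
leaving the unit ball too fast. -/
theorem exists_pos_normP_sub_smul_le [NeZero n] {x y : Fin n → ℝ} (hx : normP x ≤ 1)
    (hy : normP y ≤ 1) (h : face x ≤ face y) : ∃ ε : ℝ, 0 < ε ∧ normP (x - ε • y) ≤ 1 - ε := by
  have key : ∀ i j, ∀ᶠ ε : ℝ in nhdsWithin 0 (Set.Ioi 0),
      (x i - x j) - ε * (y i - y j) ≤ 2 * (1 - ε) := by
    intro i j
    have hxij := sub_le_two_mul_normP x i j
    have hyji := sub_le_two_mul_normP y j i
    by_cases hij : x i - x j = 2
    · have := sub_eq_two_of_mem_face hy (h.1 (mem_face_fst.2 ⟨j, hij⟩))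
        (h.2 (mem_face_snd.2 ⟨i, hij⟩))
      refine Filter.Eventually.of_forall fun ε => ?_
      rw [hij, this]
      linarith
    · have hlt : 0 < (2 - (x i - x j)) / 4 := by
        have : x i - x j < 2 := lt_of_le_of_ne (by linarith) hij
        linarith
      filter_upwards [Ioo_mem_nhdsGT hlt] with ε hε
      nlinarith [hε.1, hε.2]
  obtain ⟨ε, hε, hpos⟩ := ((Filter.eventually_all.2 fun i =>
    Filter.eventually_all.2 (key i)).and self_mem_nhdsWithin).exists
  refine ⟨ε, hpos, ?_⟩
  obtain ⟨i, j, hij⟩ := exists_sub_eq_two_mul_normP (x - ε • y)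
  have := hε i j
  simp only [Pi.sub_apply, Pi.smul_apply, smul_eq_mul] at hij
  linarith

theorem NonexpansiveP.face_mono [NeZero n] {M : Matrix (Fin n) (Fin n) ℝ} (hM : NonexpansiveP M)
    {x y : Fin n → ℝ} (hx : normP x ≤ 1) (hy : normP y ≤ 1) (h : face x ≤ face y) :
    face (M.mulVec x) ≤ face (M.mulVec y) := by
  obtain ⟨ε, hε, hxy⟩ := exists_pos_normP_sub_smul_le hx hy h
  have key : ∀ i j, M.mulVec x i - M.mulVec x j = 2 → M.mulVec y i - M.mulVec y j = 2 := by
    intro i j hij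
    have h₁ := sub_le_two_mul_normP (M.mulVec (x - ε • y)) i j
    have h₂ := sub_le_two_mul_normP (M.mulVec y) i j
    have h₃ := hM (x - ε • y)
    have h₄ := hM y
    simp only [Matrix.mulVec_sub, Matrix.mulVec_smul, Pi.sub_apply, Pi.smul_apply,
      smul_eq_mul] at h₁ h₃
    have h₅ : ε * 2 ≤ ε * (M.mulVec y i - M.mulVec y j) := by linarith
    have h₆ := le_of_mul_le_mul_left h₅ hε
    linarith
  constructor
  · intro i hi
    obtain ⟨j, hj⟩ := mem_face_fst.1 hi
    exact mem_face_fst.2 ⟨j, key i j hj⟩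
  · intro j hj
    obtain ⟨i, hi⟩ := mem_face_snd.1 hj
    exact mem_face_snd.2 ⟨i, key i j hi⟩

/-- `FaceLE y x` means that, up to sign, `y` lies in the closed face spanned by `x`. -/
def FaceLE (y x : Fin n → ℝ) : Prop :=
  face x ≤ face y ∨ (face x).swap ≤ face y

theorem FaceLE.trans {x y z : Fin n → ℝ} (h : FaceLE x y) (h' : FaceLE y z) : FaceLE x z := by
  rcases h with h | h <;> rcases h' with h' | h'
  · exact Or.inl (h'.trans h)
  · exact Or.inr (h'.trans h)
  · exact Or.inr ((Prod.swap_le_swap.2 h').trans h)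
  · exact Or.inl (le_trans (by simpa using Prod.swap_le_swap.2 h') h)

theorem NonexpansiveP.faceLE_mulVec [NeZero n] {M : Matrix (Fin n) (Fin n) ℝ}
    (hM : NonexpansiveP M) {x y : Fin n → ℝ} (hx : normP x ≤ 1) (hy : normP y ≤ 1)
    (h : FaceLE y x) : FaceLE (M.mulVec y) (M.mulVec x) := by
  rcases h with h | h
  · exact Or.inl (hM.face_mono hx hy h)
  · rw [← face_neg] at h
    have := hM.face_mono ((normP_neg x).trans_le hx) hy h
    rw [Matrix.mulVec_neg, face_neg] at this
    exact Or.inr this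

theorem FaceLE.normP_eq_one [NeZero n] {x y : Fin n → ℝ} (h : FaceLE y x) (hx : normP x = 1)
    (hy : normP y ≤ 1) : normP y = 1 := by
  obtain ⟨⟨i, hi⟩, ⟨j, hj⟩⟩ := face_nonempty hx
  rcases h with h | h
  · exact normP_eq_one_of_mem_face hy (h.1 hi)
  · exact normP_eq_one_of_mem_face hy (h.1 hj)

end NormP

section Words

variable {n : ℕ}

/-- A word over `Sig` whose product maps the face of some point `x` of the unit sphere into the
closure of that face, up to sign. -/
def Recurrent (Sig : Finset (Matrix (Fin n) (Fin n) ℝ)) (l : List (Matrix (Fin n) (Fin n) ℝ))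
    (x : Fin n → ℝ) : Prop :=
  (∀ M ∈ l, M ∈ Sig) ∧ normP x ≤ 1 ∧ normP (l.prod.mulVec x) = 1 ∧ FaceLE (l.prod.mulVec x) x

variable {Sig : Finset (Matrix (Fin n) (Fin n) ℝ)}
  {l : List (Matrix (Fin n) (Fin n) ℝ)} {x : Fin n → ℝ}

/-- Partial products of a recurrent word keep the point on the unit sphere. -/
theorem Recurrent.normP_drop (hS : ∀ M ∈ Sig, NonexpansiveP M) (h : Recurrent Sig l x)
    (i : ℕ) : normP ((l.drop i).prod.mulVec x) = 1 := by
  obtain ⟨hl, hx, hlx, -⟩ := h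
  have h₁ : NonexpansiveP (l.drop i).prod :=
    NonexpansiveP.list_prod fun M hM => hS M (hl M (List.mem_of_mem_drop hM))
  have h₂ : NonexpansiveP (l.take i).prod :=
    NonexpansiveP.list_prod fun M hM => hS M (hl M (List.mem_of_mem_take hM))
  refine le_antisymm ((h₁ x).trans hx) ?_
  rw [← List.prod_take_mul_prod_drop l i, ← Matrix.mulVec_mulVec] at hlx
  exact hlx ▸ h₂ _

theorem exists_list_prod_mul_partialProd {σ : ℕ → Matrix (Fin n) (Fin n) ℝ}
    (hσ : ∀ t, σ t ∈ Sig) (i d : ℕ) : ∃ l : List (Matrix (Fin n) (Fin n) ℝ),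
      l.length = d ∧ (∀ M ∈ l, M ∈ Sig) ∧ l.prod * partialProd σ i = partialProd σ (i + d) := by
  induction d with
  | zero => exact ⟨[], by simp⟩
  | succ d ih =>
    obtain ⟨l, hd, hl, hp⟩ := ih
    refine ⟨σ (i + d + 1) :: l, by simp [hd], ?_, ?_⟩
    · simpa using ⟨hσ _, hl⟩
    · rw [List.prod_cons, mul_assoc, hp]
      rfl

theorem exists_recurrent (hS : ∀ M ∈ Sig, NonexpansiveP M)
    {σ : ℕ → Matrix (Fin n) (Fin n) ℝ} (hσ : ∀ t, σ t ∈ Sig)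
    (hnc : ∀ t : ℕ, 1 ≤ t → ¬ ContractsP (partialProd σ t)) :
    ∃ l x, l ≠ [] ∧ Recurrent Sig l x := by
  set N := Fintype.card (Finset (Fin n) × Finset (Fin n))
  have hN := hnc N Fintype.card_pos
  simp only [ContractsP, not_forall, not_lt] at hN
  obtain ⟨y, hy, hNy⟩ := hN
  have hanti : Antitone fun t => normP ((partialProd σ t).mulVec y) := by
    refine antitone_nat_of_succ_le fun t => ?_
    rw [partialProd, ← Matrix.mulVec_mulVec]
    exact hS _ (hσ _) _
  have hone : ∀ t ≤ N, normP ((partialProd σ t).mulVec y) = 1 := fun t ht =>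
    le_antisymm ((hanti t.zero_le).trans (by simpa [partialProd] using hy))
      (hNy.trans (hanti ht))
  obtain ⟨i, j, hij, hface⟩ := Fintype.exists_ne_map_eq_of_card_lt
    (fun t : Fin (N + 1) => face ((partialProd σ t).mulVec y)) (by simp [N])
  wlog hlt : i < j generalizing i j
  · exact this j i hij.symm hface.symm (lt_of_le_of_ne (not_lt.1 hlt) hij.symm)
  obtain ⟨l, hd, hl, hp⟩ := exists_list_prod_mul_partialProd hσ i (j - i)
  have hlt' : (i : ℕ) < j := hlt
  rw [Nat.add_sub_cancel' hlt'.le] at hp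
  refine ⟨l, (partialProd σ i).mulVec y, ?_, hl, (hone i (by omega)).le, ?_, ?_⟩
  · rw [← List.length_pos_iff]
    omega
  · rw [Matrix.mulVec_mulVec, hp]
    exact hone j (by omega)
  · rw [Matrix.mulVec_mulVec, hp]
    exact Or.inl hface.le

variable [NeZero n]

theorem Recurrent.normP_pow_mulVec (hS : ∀ M ∈ Sig, NonexpansiveP M) (h : Recurrent Sig l x)
    (k : ℕ) : normP ((l.prod ^ k).mulVec x) = 1 := by
  obtain ⟨hl, hx, hlx, hle⟩ := h
  have hM : NonexpansiveP l.prod := NonexpansiveP.list_prod fun M hM => hS M (hl M hM)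
  have hx1 : normP x = 1 := le_antisymm hx (hlx ▸ hM x)
  suffices ∀ k, normP ((l.prod ^ (k + 1)).mulVec x) = 1 ∧
      FaceLE ((l.prod ^ (k + 1)).mulVec x) x by
    cases k with
    | zero => simpa using hx1
    | succ k => exact (this k).1
  intro k
  induction k with
  | zero => simpa using ⟨hlx, hle⟩
  | succ k ih =>
    have h₁ := hM.faceLE_mulVec hx ih.1.le ih.2
    have h₂ := (hM _).trans ih.1.le
    rw [pow_succ', ← Matrix.mulVec_mulVec]
    exact ⟨h₁.normP_eq_one hlx h₂, h₁.trans hle⟩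

/-- The points visited by a recurrent word of minimal length lie in pairwise incomparable faces. -/
theorem Recurrent.not_faceLE_of_minimal (hS : ∀ M ∈ Sig, NonexpansiveP M) (h : Recurrent Sig l x)
    (hmin : ∀ l' x', l' ≠ [] → Recurrent Sig l' x' → l.length ≤ l'.length) {i j : ℕ}
    (hi : 1 ≤ i) (hij : i < j) (hj : j ≤ l.length) :
    ¬ FaceLE ((l.drop i).prod.mulVec x) ((l.drop j).prod.mulVec x) ∧
      ¬ FaceLE ((l.drop j).prod.mulVec x) ((l.drop i).prod.mulVec x) := by
  have hxi := h.normP_drop hS i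
  have hxj := h.normP_drop hS j
  obtain ⟨hl, hx, hlx, hle⟩ := h
  constructor
  · intro hle'
    have hprod : ((l.drop i).take (j - i)).prod.mulVec ((l.drop j).prod.mulVec x) =
        (l.drop i).prod.mulVec x := by
      rw [Matrix.mulVec_mulVec]
      conv_rhs => rw [← List.prod_take_mul_prod_drop (l.drop i) (j - i), List.drop_drop,
        Nat.add_sub_cancel' hij.le]
    have := hmin ((l.drop i).take (j - i)) ((l.drop j).prod.mulVec x)
      (by rw [← List.length_pos_iff]; simp; omega)
      ⟨fun M hM => hl M (List.mem_of_mem_drop (List.mem_of_mem_take hM)), hxj.le,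
        by rw [hprod, hxi], by rwa [hprod]⟩
    simp at this
    omega
  · intro hle'
    have hN : NonexpansiveP (l.drop j ++ l.take i).prod := by
      refine NonexpansiveP.list_prod fun M hM => hS M (hl M ?_)
      rcases List.mem_append.1 hM with hM | hM
      exacts [List.mem_of_mem_drop hM, List.mem_of_mem_take hM]
    have hNj : NonexpansiveP (l.drop j).prod :=
      NonexpansiveP.list_prod fun M hM => hS M (hl M (List.mem_of_mem_drop hM))
    have hprod : (l.drop j ++ l.take i).prod.mulVec ((l.drop i).prod.mulVec x) =
        (l.drop j).prod.mulVec (l.prod.mulVec x) := by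
      rw [List.prod_append, ← Matrix.mulVec_mulVec, Matrix.mulVec_mulVec _ (l.take i).prod,
        List.prod_take_mul_prod_drop]
    have hle₂ := hNj.faceLE_mulVec hx hlx.le hle
    have := hmin (l.drop j ++ l.take i) ((l.drop i).prod.mulVec x)
      (by rw [← List.length_pos_iff]; simp; omega)
      ⟨fun M hM => ?_, hxi.le, ?_, ?_⟩
    · simp at this
      omega
    · rcases List.mem_append.1 hM with hM | hM
      exacts [hl M (List.mem_of_mem_drop hM), hl M (List.mem_of_mem_take hM)]
    · rw [hprod]
      exact hle₂.normP_eq_one hxj ((hNj _).trans hlx.le)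
    · rw [hprod]
      exact hle₂.trans hle'

end Words

section Sperner

open Finset

/-- In a graded poset whose levels expand upwards until level `k`, the part of an antichain up to
level `k` is at most as large as its upper shadow on level `k`. -/
theorem exists_shadow_of_antichain {α : Type*} (r : α → α → Prop) [IsPartialOrder α r]
    (ℓ : α → ℕ) {Q A : Finset α} (hAQ : A ⊆ Q) (hA : IsAntichain r (A : Set α)) {k : ℕ}
    (h : ∀ j < k, ∀ s ⊆ Q, (∀ a ∈ s, ℓ a = j) →
      ∃ t ⊆ Q, #s ≤ #t ∧ ∀ b ∈ t, ℓ b = j + 1 ∧ ∃ a ∈ s, r a b) :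
    ∃ t ⊆ Q, #{a ∈ A | ℓ a ≤ k} ≤ #t ∧ ∀ b ∈ t, ℓ b = k ∧ ∃ a ∈ A, ℓ a ≤ k ∧ r a b := by
  classical
  induction k with
  | zero =>
    refine ⟨{a ∈ A | ℓ a ≤ 0}, (filter_subset _ _).trans hAQ, le_rfl, fun a ha => ?_⟩
    obtain ⟨ha, h0⟩ := mem_filter.1 ha
    exact ⟨Nat.le_zero.1 h0, a, ha, h0, refl_of r a⟩
  | succ j ih =>
    obtain ⟨s, hsQ, hs, hsA⟩ := ih fun i hi => h i (by omega)
    obtain ⟨t, htQ, ht, hts⟩ := h j (by omega) s hsQ fun a ha => (hsA a ha).1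
    have hsplit : {a ∈ A | ℓ a ≤ j + 1} ⊆ {a ∈ A | ℓ a ≤ j} ∪ {a ∈ A | ℓ a = j + 1} := by
      intro a ha
      simp only [mem_union, mem_filter] at ha ⊢
      grind
    have hdisj : Disjoint t {a ∈ A | ℓ a = j + 1} := by
      refine disjoint_left.2 fun b hb hb' => ?_
      obtain ⟨hbj, a, ha, hab⟩ := hts b hb
      obtain ⟨haj, c, hc, -, hca⟩ := hsA a ha
      have hcb := hA.eq hc (mem_filter.1 hb').1 (trans_of r hca hab)
      have hba : r b a := hcb ▸ hca
      rw [antisymm_of r hab hba, hbj] at haj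
      omega
    refine ⟨t ∪ {a ∈ A | ℓ a = j + 1}, union_subset htQ ((filter_subset _ _).trans hAQ), ?_, ?_⟩
    · rw [card_union_of_disjoint hdisj]
      exact (card_le_card hsplit).trans <| (card_union_le _ _).trans <|
        Nat.add_le_add_right (hs.trans ht) _
    · intro b hb
      rcases mem_union.1 hb with hb | hb
      · obtain ⟨hbj, a, ha, hab⟩ := hts b hb
        obtain ⟨haj, c, hc, hcj, hca⟩ := hsA a ha
        exact ⟨hbj, c, hc, by omega, trans_of r hca hab⟩
      · obtain ⟨hbA, hbj⟩ := mem_filter.1 hb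
        exact ⟨hbj, b, hbA, hbj.le, refl_of r b⟩

variable {n : ℕ}

/-- Pairs of disjoint nonempty subsets of `Fin n`. -/
def disjointPairs (n : ℕ) : Finset (Finset (Fin n) × Finset (Fin n)) :=
  {p | Disjoint p.1 p.2 ∧ p.1.Nonempty ∧ p.2.Nonempty}

theorem mem_disjointPairs {p : Finset (Fin n) × Finset (Fin n)} :
    p ∈ disjointPairs n ↔ Disjoint p.1 p.2 ∧ p.1.Nonempty ∧ p.2.Nonempty := by
  simp [disjointPairs]

/-- The rank of a pair of subsets. -/
def pairSize (p : Finset (Fin n) × Finset (Fin n)) : ℕ := #p.1 + #p.2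

theorem pairSize_le {p : Finset (Fin n) × Finset (Fin n)} (hp : p ∈ disjointPairs n) :
    pairSize p ≤ n := by
  rw [pairSize, ← card_union_of_disjoint (mem_disjointPairs.1 hp).1]
  exact card_finset_fin_le _

/-- `a` arises from `b` by deleting one point. -/
def PairCovBy (a b : Finset (Fin n) × Finset (Fin n)) : Prop :=
  ∃ i ∈ b.1 ∪ b.2, (b.1.erase i, b.2.erase i) = a

instance (a b : Finset (Fin n) × Finset (Fin n)) : Decidable (PairCovBy a b) := by
  unfold PairCovBy
  infer_instance

theorem PairCovBy.le {a b : Finset (Fin n) × Finset (Fin n)} (h : PairCovBy a b) : a ≤ b := by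
  obtain ⟨i, -, rfl⟩ := h
  exact ⟨erase_subset _ _, erase_subset _ _⟩

theorem pairCovBy_iff {a b : Finset (Fin n) × Finset (Fin n)} (hb : b ∈ disjointPairs n) :
    PairCovBy a b ↔ ∃ i ∈ (a.1 ∪ a.2)ᶜ, b = (insert i a.1, a.2) ∨ b = (a.1, insert i a.2) := by
  obtain ⟨b₁, b₂⟩ := b
  obtain ⟨a₁, a₂⟩ := a
  have hd := disjoint_left.1 (mem_disjointPairs.1 hb).1
  simp only [PairCovBy, Prod.mk.injEq, mem_compl, mem_union, not_or] at hd ⊢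
  constructor
  · rintro ⟨i, hi | hi, rfl, rfl⟩
    · exact ⟨i, by simp, Or.inl ⟨by rw [insert_erase hi], by rw [erase_eq_of_notMem (hd hi)]⟩⟩
    · have := fun h => hd h hi
      exact ⟨i, by simp, Or.inr ⟨by rw [erase_eq_of_notMem this], by rw [insert_erase hi]⟩⟩
  · rintro ⟨i, ⟨h₁, h₂⟩, ⟨rfl, rfl⟩ | ⟨rfl, rfl⟩⟩
    · exact ⟨i, by simp, erase_insert h₁, erase_eq_of_notMem h₂⟩
    · exact ⟨i, by simp, erase_eq_of_notMem h₁, erase_insert h₂⟩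

theorem PairCovBy.pairSize_eq {a b : Finset (Fin n) × Finset (Fin n)}
    (hb : b ∈ disjointPairs n) (h : PairCovBy a b) : pairSize b = pairSize a + 1 := by
  obtain ⟨i, hi, rfl | rfl⟩ := (pairCovBy_iff hb).1 h <;>
  · simp only [mem_compl, mem_union, not_or] at hi
    simp only [pairSize, card_insert_of_notMem hi.1, card_insert_of_notMem hi.2]
    omega

theorem card_pairCovBy_above {a : Finset (Fin n) × Finset (Fin n)} (ha : a ∈ disjointPairs n) :
    #{b ∈ disjointPairs n | PairCovBy a b} = 2 * (n - pairSize a) := by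
  obtain ⟨hd, h₁, h₂⟩ := mem_disjointPairs.1 ha
  have heq : {b ∈ disjointPairs n | PairCovBy a b} =
      (a.1 ∪ a.2)ᶜ.image (fun i => (insert i a.1, a.2)) ∪
        (a.1 ∪ a.2)ᶜ.image (fun i => (a.1, insert i a.2)) := by
    ext b
    constructor
    · intro hb
      obtain ⟨hb, hab⟩ := mem_filter.1 hb
      obtain ⟨i, hi, rfl | rfl⟩ := (pairCovBy_iff hb).1 hab
      · exact mem_union_left _ (mem_image_of_mem _ hi)
      · exact mem_union_right _ (mem_image_of_mem _ hi)
    · intro hb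
      have hb' : ∃ i ∈ (a.1 ∪ a.2)ᶜ, b = (insert i a.1, a.2) ∨ b = (a.1, insert i a.2) := by
        simp only [mem_union, mem_image] at hb
        rcases hb with ⟨i, hi, rfl⟩ | ⟨i, hi, rfl⟩
        exacts [⟨i, hi, Or.inl rfl⟩, ⟨i, hi, Or.inr rfl⟩]
      have hbQ : b ∈ disjointPairs n := by
        obtain ⟨i, hi, rfl | rfl⟩ := hb' <;>
        · simp only [mem_compl, mem_union, not_or] at hi
          simp [mem_disjointPairs, hd, h₁, h₂, hi]
      exact mem_filter.2 ⟨hbQ, (pairCovBy_iff hbQ).2 hb'⟩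
  have hinj : ∀ s ⊆ a.1 ∪ a.2, Set.InjOn (fun i => insert i s) ((a.1 ∪ a.2)ᶜ : Finset (Fin n)) := by
    intro s hs i hi j hj hij
    have : i ∈ insert j s := (show insert i s = insert j s from hij) ▸ mem_insert_self i s
    rcases mem_insert.1 this with h | h
    · exact h
    · exact absurd (hs h) (by simpa using hi)
  rw [heq, card_union_of_disjoint, card_image_of_injOn, card_image_of_injOn, card_compl,
    card_union_of_disjoint hd, Fintype.card_fin, pairSize, two_mul]
  · exact fun i hi j hj hij => hinj _ subset_union_right hi hj (Prod.ext_iff.1 hij).2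
  · exact fun i hi j hj hij => hinj _ subset_union_left hi hj (Prod.ext_iff.1 hij).1
  · refine disjoint_left.2 fun b hb hb' => ?_
    obtain ⟨i, hi, rfl⟩ := mem_image.1 hb
    obtain ⟨j, hj, hij⟩ := mem_image.1 hb'
    have : i ∈ a.1 := by
      rw [(Prod.ext_iff.1 hij).1]
      exact mem_insert_self _ _
    simp [this] at hi

theorem card_pairCovBy_below_le {b : Finset (Fin n) × Finset (Fin n)}
    (hb : b ∈ disjointPairs n) : #{a ∈ disjointPairs n | PairCovBy a b} ≤ pairSize b := by
  rw [pairSize, ← card_union_of_disjoint (mem_disjointPairs.1 hb).1]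
  refine (card_le_card fun a ha => ?_).trans
    (card_image_le (f := fun i => (b.1.erase i, b.2.erase i)))
  exact mem_image.2 (mem_filter.1 ha).2

theorem le_card_pairCovBy_below {b : Finset (Fin n) × Finset (Fin n)}
    (hb : b ∈ disjointPairs n) (h3 : 3 ≤ pairSize b) :
    pairSize b - 1 ≤ #{a ∈ disjointPairs n | PairCovBy a b} := by
  obtain ⟨hd, h₁, h₂⟩ := mem_disjointPairs.1 hb
  have hinj : Set.InjOn (fun i => (b.1.erase i, b.2.erase i)) (b.1 ∪ b.2 : Finset (Fin n)) := by
    intro i hi j hj hij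
    by_contra hne
    simp only [Prod.mk.injEq] at hij
    rcases mem_union.1 (mem_coe.1 hi) with h | h
    · have : i ∈ b.1.erase i := hij.1 ▸ mem_erase.2 ⟨hne, h⟩
      simp at this
    · have : i ∈ b.2.erase i := hij.2 ▸ mem_erase.2 ⟨hne, h⟩
      simp at this
  have key : ∃ i₀, ∀ i ∈ (b.1 ∪ b.2).erase i₀, (b.1.erase i).Nonempty ∧ (b.2.erase i).Nonempty := by
    unfold pairSize at h3
    rcases lt_or_ge 1 (#b.1) with h | h
    · obtain ⟨i₀, hi₀⟩ := h₂
      refine ⟨i₀, fun i hi => ⟨?_, i₀, mem_erase.2 ⟨(ne_of_mem_erase hi).symm, hi₀⟩⟩⟩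
      exact (exists_mem_ne h i).imp fun k hk => mem_erase.2 ⟨hk.2, hk.1⟩
    · obtain ⟨i₀, hi₀⟩ := h₁
      refine ⟨i₀, fun i hi => ⟨⟨i₀, mem_erase.2 ⟨(ne_of_mem_erase hi).symm, hi₀⟩⟩, ?_⟩⟩
      exact (exists_mem_ne (by omega) i).imp fun k hk => mem_erase.2 ⟨hk.2, hk.1⟩
  obtain ⟨i₀, hi₀⟩ := key
  rw [pairSize, ← card_union_of_disjoint hd]
  calc #(b.1 ∪ b.2) - 1 ≤ #((b.1 ∪ b.2).erase i₀) := pred_card_le_card_erase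
    _ = #(((b.1 ∪ b.2).erase i₀).image fun i => (b.1.erase i, b.2.erase i)) :=
      (card_image_of_injOn (hinj.mono (by simp))).symm
    _ ≤ _ := by
      refine card_le_card fun a ha => ?_
      obtain ⟨i, hi, rfl⟩ := mem_image.1 ha
      refine mem_filter.2 ⟨mem_disjointPairs.2 ⟨?_, hi₀ i hi⟩, i, mem_of_mem_erase hi, rfl⟩
      exact hd.mono (erase_subset _ _) (erase_subset _ _)

theorem card_le_card_upper_shadow {j : ℕ} (hj : 3 * j < 2 * n)
    {s : Finset (Finset (Fin n) × Finset (Fin n))} (hs : s ⊆ disjointPairs n)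
    (hsj : ∀ a ∈ s, pairSize a = j) :
    #s ≤ #{b ∈ disjointPairs n | pairSize b = j + 1 ∧ ∃ a ∈ s, a ≤ b} := by
  have := card_mul_le_card_mul PairCovBy (s := s)
    (t := {b ∈ disjointPairs n | pairSize b = j + 1 ∧ ∃ a ∈ s, a ≤ b})
    (m := 2 * (n - j)) (n := 2 * (n - j)) (fun a ha => ?_) (fun b hb => ?_)
  · exact Nat.le_of_mul_le_mul_right this (by omega)
  · rw [← hsj a ha, ← card_pairCovBy_above (hs ha)]
    refine card_le_card fun b hb => ?_
    obtain ⟨hb, hab⟩ := mem_filter.1 hb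
    exact (mem_bipartiteAbove _).2
      ⟨mem_filter.2 ⟨hb, by rw [hab.pairSize_eq hb], a, ha, hab.le⟩, hab⟩
  · obtain ⟨hbQ, hbj, -⟩ := mem_filter.1 hb
    calc #(bipartiteBelow PairCovBy s b) ≤ #{a ∈ disjointPairs n | PairCovBy a b} :=
          card_le_card (filter_subset_filter _ hs)
      _ ≤ pairSize b := card_pairCovBy_below_le hbQ
      _ ≤ _ := by omega

theorem card_le_card_lower_shadow {j : ℕ} (hj2 : 2 ≤ j) (hj : 2 * n ≤ 3 * j)
    {s : Finset (Finset (Fin n) × Finset (Fin n))} (hs : s ⊆ disjointPairs n)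
    (hsj : ∀ b ∈ s, pairSize b = j + 1) :
    #s ≤ #{a ∈ disjointPairs n | pairSize a = j ∧ ∃ b ∈ s, a ≤ b} := by
  have := card_mul_le_card_mul' PairCovBy (t := s)
    (s := {a ∈ disjointPairs n | pairSize a = j ∧ ∃ b ∈ s, a ≤ b})
    (m := j) (n := j) (fun b hb => ?_) (fun a ha => ?_)
  · exact Nat.le_of_mul_le_mul_right this (by omega)
  · have hbj := hsj b hb
    have := le_card_pairCovBy_below (hs hb) (by omega)
    rw [hbj, Nat.add_sub_cancel] at this
    refine this.trans (card_le_card fun a ha => ?_)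
    obtain ⟨ha, hab⟩ := mem_filter.1 ha
    have := hab.pairSize_eq (hs hb)
    exact (mem_bipartiteBelow _).2 ⟨mem_filter.2 ⟨ha, by omega, b, hb, hab.le⟩, hab⟩
  · obtain ⟨haQ, haj, -⟩ := mem_filter.1 ha
    calc #(bipartiteAbove PairCovBy s a) ≤ #{b ∈ disjointPairs n | PairCovBy a b} :=
          card_le_card (filter_subset_filter _ hs)
      _ = 2 * (n - pairSize a) := card_pairCovBy_above haQ
      _ ≤ _ := by omega

theorem card_disjointPairs_level_le (m : ℕ) :
    #{p ∈ disjointPairs n | pairSize p = m} ≤ n.choose m * (2 ^ m - 2) := by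
  have h := card_biUnion_le_card_mul (powersetCard m (univ : Finset (Fin n)))
    (fun U => ((U.powerset.erase ∅).erase U).image fun S => (S, U \ S)) (2 ^ m - 2) ?_
  · rw [card_powersetCard, card_univ, Fintype.card_fin] at h
    refine (card_le_card fun p hp => ?_).trans h
    obtain ⟨hp, hpm⟩ := mem_filter.1 hp
    obtain ⟨hd, h₁, h₂⟩ := mem_disjointPairs.1 hp
    refine mem_biUnion.2 ⟨p.1 ∪ p.2, mem_powersetCard.2 ⟨subset_univ _, ?_⟩,
      mem_image.2 ⟨p.1, ?_, ?_⟩⟩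
    · rw [card_union_of_disjoint hd]
      exact hpm
    · simp only [mem_erase, mem_powerset, subset_union_left, and_true]
      refine ⟨fun h => h₂.ne_empty ?_, h₁.ne_empty⟩
      exact disjoint_self.1 (hd.mono_left (h ▸ subset_union_right))
    · rw [union_sdiff_cancel_left hd]
  · intro U hU
    obtain ⟨-, hU⟩ := mem_powersetCard.1 hU
    refine card_image_le.trans ?_
    rcases U.eq_empty_or_nonempty with rfl | hne
    · simp
    rw [card_erase_of_mem (by simp [hne.ne_empty]), card_erase_of_mem (by simp), card_powerset, hU]
    omega

/-- Sperner's theorem for pairs of disjoint nonempty subsets. -/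
theorem IsAntichain.card_le_of_subset_disjointPairs (hn : 2 ≤ n)
    {A : Finset (Finset (Fin n) × Finset (Fin n))} (hAQ : A ⊆ disjointPairs n)
    (hA : IsAntichain (· ≤ ·) (A : Set (Finset (Fin n) × Finset (Fin n)))) :
    #A ≤ n.choose (n / 3) * (2 ^ (n - n / 3) - 2) := by
  obtain ⟨m, hm⟩ : ∃ m, m = n - n / 3 := ⟨_, rfl⟩
  obtain ⟨U, hUQ, hU, hUA⟩ := exists_shadow_of_antichain (· ≤ ·) pairSize hAQ hA (k := m)
    fun j hj s hs hsj => ⟨_, filter_subset _ _, card_le_card_upper_shadow (by omega) hs hsj,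
      fun b hb => (mem_filter.1 hb).2⟩
  have hA' : IsAntichain (· ≥ ·)
      (({a ∈ A | m < pairSize a} : Finset _) : Set (Finset (Fin n) × Finset (Fin n))) :=
    hA.flip.subset (coe_subset.2 (filter_subset _ A))
  obtain ⟨D, hDQ, hD, hDA⟩ := exists_shadow_of_antichain (· ≥ ·) (fun p => n - pairSize p)
    ((filter_subset _ _).trans hAQ) hA' (k := n - m) fun j hj s hs hsj => by
      refine ⟨_, filter_subset _ _, card_le_card_lower_shadow (n := n) (j := n - (j + 1))
        (by omega) (by omega) hs fun b hb => ?_, fun a ha => ?_⟩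
      · have := hsj b hb
        have := pairSize_le (hs hb)
        omega
      · have := (mem_filter.1 ha).2
        exact ⟨by omega, this.2⟩
  rw [filter_true_of_mem fun a ha => by
    have := (mem_filter.1 ha).2
    omega] at hD
  have hdisj : Disjoint U D := by
    refine disjoint_left.2 fun b hb hb' => ?_
    obtain ⟨-, a, ha, ham, hab⟩ := hUA b hb
    obtain ⟨-, c, hc, -, hbc⟩ := hDA b hb'
    obtain ⟨hc, hcm⟩ := mem_filter.1 hc
    have := hA.eq ha hc (hab.trans hbc)
    rw [this] at ham
    omega
  calc #A = #{a ∈ A | pairSize a ≤ m} + #{a ∈ A | m < pairSize a} := by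
        rw [← card_filter_add_card_filter_not (fun a => pairSize a ≤ m)]
        simp only [not_le]
    _ ≤ #U + #D := Nat.add_le_add hU hD
    _ = #(U ∪ D) := (card_union_of_disjoint hdisj).symm
    _ ≤ #{p ∈ disjointPairs n | pairSize p = m} := by
        refine card_le_card fun b hb => ?_
        rcases mem_union.1 hb with hb | hb
        · exact mem_filter.2 ⟨hUQ hb, (hUA b hb).1⟩
        · have := pairSize_le (hDQ hb)
          have := (hDA b hb).1
          exact mem_filter.2 ⟨hDQ hb, by omega⟩
    _ ≤ n.choose m * (2 ^ m - 2) := card_disjointPairs_level_le m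
    _ = _ := by rw [hm, Nat.choose_symm (Nat.div_le_self n 3)]

end Sperner

section Words

variable {n : ℕ} [NeZero n] {Sig : Finset (Matrix (Fin n) (Fin n) ℝ)}
  {l : List (Matrix (Fin n) (Fin n) ℝ)} {x : Fin n → ℝ}

theorem Recurrent.length_le_pstar (hn : 2 ≤ n) (hS : ∀ M ∈ Sig, NonexpansiveP M)
    (h : Recurrent Sig l x)
    (hmin : ∀ l' x', l' ≠ [] → Recurrent Sig l' x' → l.length ≤ l'.length) :
    l.length ≤ pstar n := by
  classical
  set f : ℕ → Finset (Fin n) × Finset (Fin n) := fun i => face ((l.drop i).prod.mulVec x)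
    with hf
  set g : ℕ × Bool → Finset (Fin n) × Finset (Fin n) := fun p =>
    if p.2 then f p.1 else (f p.1).swap with hg
  have hone := h.normP_drop hS
  have hfmem : ∀ i, f i ∈ disjointPairs n := fun i =>
    mem_disjointPairs.2 ⟨disjoint_face (hone i).le, face_nonempty (hone i)⟩
  have hswap : ∀ i, ¬ f i ≤ (f i).swap := fun i hi => by
    obtain ⟨hd, h₁, -⟩ := mem_disjointPairs.1 (hfmem i)
    exact h₁.ne_empty (Finset.disjoint_self_iff_empty _ |>.1 (hd.mono_right hi.1))
  have hcomp : ∀ i ∈ Finset.Icc 1 l.length, ∀ j ∈ Finset.Icc 1 l.length, i ≠ j →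
      ¬ (f i ≤ f j ∨ (f i).swap ≤ f j) := by
    intro i hi j hj hij
    rw [Finset.mem_Icc] at hi hj
    rcases lt_or_gt_of_ne hij with hlt | hlt
    · exact (h.not_faceLE_of_minimal hS hmin hi.1 hlt hj.2).2
    · exact (h.not_faceLE_of_minimal hS hmin hj.1 hlt hi.2).1
  have hg_le : ∀ p ∈ Finset.Icc 1 l.length ×ˢ (Finset.univ : Finset Bool),
      ∀ q ∈ Finset.Icc 1 l.length ×ˢ (Finset.univ : Finset Bool), g p ≤ g q → p = q := by
    rintro ⟨i, b⟩ hi ⟨j, c⟩ hj hle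
    simp only [Finset.mem_product, Finset.mem_univ, and_true] at hi hj
    have hle' : f i ≤ f j ∨ (f i).swap ≤ f j := by
      cases b <;> cases c <;> simp only [hg, if_true, Bool.false_eq_true, if_false] at hle
      · exact Or.inl (Prod.swap_le_swap.1 hle)
      · exact Or.inr hle
      · exact Or.inr (by simpa using Prod.swap_le_swap.2 hle)
      · exact Or.inl hle
    have hij : i = j := by_contra fun hij => hcomp i hi j hj hij hle'
    subst hij
    cases b <;> cases c <;> simp only [hg, if_true, Bool.false_eq_true, if_false] at hle
    · rfl
    · exact absurd (by simpa using Prod.swap_le_swap.2 hle) (hswap i)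
    · exact absurd hle (hswap i)
    · rfl
  have hcard : ((Finset.Icc 1 l.length ×ˢ (Finset.univ : Finset Bool)).image g).card =
      l.length * 2 := by
    rw [Finset.card_image_of_injOn fun p hp q hq hpq => hg_le p hp q hq hpq.le]
    simp
  have hle := IsAntichain.card_le_of_subset_disjointPairs hn
    (A := (Finset.Icc 1 l.length ×ˢ (Finset.univ : Finset Bool)).image g) ?_ ?_
  · have hpow : 2 ^ (n - n / 3) - 2 = (2 ^ (n - n / 3 - 1) - 1) * 2 := by
      obtain ⟨m, hm⟩ : ∃ m, n - n / 3 = m + 1 := ⟨n - n / 3 - 1, by omega⟩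
      rw [hm, Nat.add_sub_cancel, pow_succ]
      omega
    rw [hcard, hpow, ← mul_assoc] at hle
    exact Nat.le_of_mul_le_mul_right hle two_pos
  · intro p hp
    obtain ⟨⟨i, b⟩, -, rfl⟩ := Finset.mem_image.1 hp
    obtain ⟨hd, h₁, h₂⟩ := mem_disjointPairs.1 (hfmem i)
    cases b
    · exact mem_disjointPairs.2 ⟨hd.symm, h₂, h₁⟩
    · exact hfmem i
  · intro p hp q hq hne hle
    obtain ⟨p', hp', rfl⟩ := Finset.mem_image.1 hp
    obtain ⟨q', hq', rfl⟩ := Finset.mem_image.1 hq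
    exact hne (congrArg g (hg_le p' hp' q' hq' hle))

end Words

theorem stmt2 (n : ℕ) (hn : 2 ≤ n) (Sig : Finset (Matrix (Fin n) (Fin n) ℝ))
    (hmono : ∀ A ∈ Sig, ∀ x : Fin n → ℝ, normP (A.mulVec x) ≤ normP x)
    (σ : ℕ → Matrix (Fin n) (Fin n) ℝ) (hσ : ∀ t, σ t ∈ Sig)
    (hnc : ∀ t : ℕ, 1 ≤ t → ¬ ContractsP (partialProd σ t)) :
    ∃ p : ℕ, 1 ≤ p ∧ p ≤ pstar n ∧
      ∃ B : Fin p → Matrix (Fin n) (Fin n) ℝ, (∀ i, B i ∈ Sig) ∧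
        ∀ k : ℕ, 1 ≤ k →
          ∃ x : Fin n → ℝ, normP x ≤ 1 ∧ 1 ≤ normP (((List.ofFn B).prod ^ k).mulVec x) := by
  have : NeZero n := ⟨by omega⟩
  have hex : ∃ p l x, l ≠ [] ∧ Recurrent Sig l x ∧ l.length = p := by
    obtain ⟨l, x, hl, hlx⟩ := exists_recurrent hmono hσ hnc
    exact ⟨_, l, x, hl, hlx, rfl⟩
  classical
  obtain ⟨l, x, hne, hl, hlen⟩ := Nat.find_spec hex
  have hmin : ∀ l' x', l' ≠ [] → Recurrent Sig l' x' → l.length ≤ l'.length :=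
    fun l' x' hne' hl' => hlen ▸ Nat.find_min' hex ⟨l', x', hne', hl', rfl⟩
  refine ⟨l.length, List.length_pos_iff.2 hne, hl.length_le_pstar hn hmono hmin, l.get,
    fun i => hl.1 _ (l.get_mem i), fun k _ => ⟨x, hl.2.1, ?_⟩⟩
  rw [List.ofFn_get]
  exact (hl.normP_pow_mulVec hmono k).ge
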